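/- Let n ≥ 1, s ∈ ℝ and 1 ≤ p, q ≤ ∞. Then there exists a constant C > 0 such that ‖e^{iΔ}f‖_{M_{p,q}} ≤ C‖f‖_{M^s_{p,q}} for all f ∈ 𝒮(ℝⁿ) if and only if s ≥ 0. -/

import Mathlib

open MeasureTheory Real
open scoped ENNReal RealInnerProductSpace

noncomputable section

/-- The short-time Fourier transform
`V_g f (x, ξ) = ∫ e^{-i ξ·t} conj (g (t - x)) f t dt`. -/
def STFT {n : ℕ} (g f : EuclideanSpace ℝ (Fin n) → ℂ)
    (x ξ : EuclideanSpace ℝ (Fin n)) : ℂ :=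
  ∫ t : EuclideanSpace ℝ (Fin n),
    Complex.exp (-(Complex.I * Complex.ofReal ⟪ξ, t⟫)) * (starRingEnd ℂ) (g (t - x)) * f t

/-- The Fourier transform `f̂ (ξ) = ∫ e^{-i ξ·x} f x dx`. -/
def FT {n : ℕ} (f : EuclideanSpace ℝ (Fin n) → ℂ) (ξ : EuclideanSpace ℝ (Fin n)) : ℂ :=
  ∫ x : EuclideanSpace ℝ (Fin n),
    Complex.exp (-(Complex.I * Complex.ofReal ⟪ξ, x⟫)) * f x

/-- The power of the Japanese bracket `⟨x⟩ˢ = (1 + |x|²)^(s/2)`. -/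
def jp {n : ℕ} (s : ℝ) (x : EuclideanSpace ℝ (Fin n)) : ℝ := (1 + ‖x‖ ^ 2) ^ (s / 2)

/-- The Gaussian window `g₀ (t) = e^{-|t|²}`. -/
def gauss {n : ℕ} (t : EuclideanSpace ℝ (Fin n)) : ℂ := Complex.ofReal (Real.exp (-‖t‖ ^ 2))

/-- The `L^p` norm (valued in `ℝ≥0∞`) of an `ℝ≥0∞`-valued function. -/
def lpN {n : ℕ} (p : ℝ≥0∞) (F : EuclideanSpace ℝ (Fin n) → ℝ≥0∞) : ℝ≥0∞ :=
  if p = ∞ then essSup F volume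
  else (∫⁻ x, F x ^ p.toReal) ^ p.toReal⁻¹

/-- The Wiener amalgam space norm `‖f‖_{W^s_{p,q}}`:
inner `L^q` norm in the frequency variable ξ, outer `L^p` norm in the space variable x,
with the Gaussian window. -/
def WNorm {n : ℕ} (s : ℝ) (p q : ℝ≥0∞) (f : EuclideanSpace ℝ (Fin n) → ℂ) : ℝ≥0∞ :=
  lpN p (fun x => lpN q (fun ξ => ENNReal.ofReal (jp s ξ) * (‖STFT gauss f x ξ‖₊ : ℝ≥0∞)))

/-- The modulation space norm `‖f‖_{M^s_{p,q}}`: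
inner `L^p` norm in the space variable x, outer `L^q` norm in the frequency variable ξ,
with the Gaussian window. -/
def MNorm {n : ℕ} (s : ℝ) (p q : ℝ≥0∞) (f : EuclideanSpace ℝ (Fin n) → ℂ) : ℝ≥0∞ :=
  lpN q (fun ξ => lpN p (fun x => ENNReal.ofReal (jp s ξ) * (‖STFT gauss f x ξ‖₊ : ℝ≥0∞)))

/-- The Schrödinger operator `e^{iεΔ} f = ℱ⁻¹ [ξ ↦ e^{-iε|ξ|²} f̂ (ξ)]` (`ε = ±1`). -/
def schrod {n : ℕ} (ε : ℝ) (f : EuclideanSpace ℝ (Fin n) → ℂ)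
    (x : EuclideanSpace ℝ (Fin n)) : ℂ :=
  (((2 * Real.pi) ^ n)⁻¹ : ℝ) *
    ∫ ξ : EuclideanSpace ℝ (Fin n),
      Complex.exp (Complex.I * Complex.ofReal ⟪x, ξ⟫) *
        Complex.exp (-(Complex.ofReal ε * Complex.I * Complex.ofReal (‖ξ‖ ^ 2))) * FT f ξ

/-- The lattice point `k ∈ ℤⁿ` viewed as a point of `ℝⁿ`. -/
def zlift {n : ℕ} (k : Fin n → ℤ) : EuclideanSpace ℝ (Fin n) :=
  (WithLp.equiv 2 (Fin n → ℝ)).symm fun i => (k i : ℝ)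


section MixedNorm

variable {n : ℕ}

lemma lpN_mono {p : ℝ≥0∞} {F G : EuclideanSpace ℝ (Fin n) → ℝ≥0∞} (h : ∀ x, F x ≤ G x) :
    lpN p F ≤ lpN p G := by
  unfold lpN
  split_ifs with hp
  · exact essSup_mono_ae (Filter.Eventually.of_forall h)
  · gcongr with x
    exact h x

lemma lpN_const_mul {p : ℝ≥0∞} (hp : 1 ≤ p) {c : ℝ≥0∞} (hc : c ≠ ∞)
    (F : EuclideanSpace ℝ (Fin n) → ℝ≥0∞) :
    lpN p (fun x => c * F x) = c * lpN p F := by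
  unfold lpN
  split_ifs with h
  · exact ENNReal.essSup_const_mul
  · have hr : 0 < p.toReal := ENNReal.toReal_pos (zero_lt_one.trans_le hp).ne' h
    simp_rw [ENNReal.mul_rpow_of_nonneg _ _ hr.le]
    rw [lintegral_const_mul' _ _ (ENNReal.rpow_ne_top_of_nonneg hr.le hc),
      ENNReal.mul_rpow_of_nonneg _ _ (inv_nonneg.2 hr.le), ENNReal.rpow_rpow_inv hr.ne']

lemma lpN_comp_add_right (p : ℝ≥0∞) (F : EuclideanSpace ℝ (Fin n) → ℝ≥0∞)
    (a : EuclideanSpace ℝ (Fin n)) : lpN p (fun x => F (x + a)) = lpN p F := by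
  unfold lpN
  split_ifs with h
  · have := (measurableEmbedding_addRight a).essSup_map_measure (μ := volume) (g := F)
    rw [map_add_right_eq_self] at this
    exact this.symm
  · rw [lintegral_add_right_eq_self (fun x => F x ^ p.toReal) a]

lemma measurable_lpN {Z : Type*} [MeasurableSpace Z] {p : ℝ≥0∞}
    {F : Z → EuclideanSpace ℝ (Fin n) → ℝ≥0∞} (hF : Measurable (Function.uncurry F)) :
    Measurable (fun z => lpN p (F z)) := by
  unfold lpN
  split_ifs with h
  · refine measurable_of_Iic fun a => ?_
    have key : {z | essSup (F z) volume ≤ a} =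
        {z | volume (Prod.mk z ⁻¹' {w : Z × EuclideanSpace ℝ (Fin n) | a < F w.1 w.2}) = 0} := by
      ext z
      have : (essSup (F z) volume ≤ a) ↔ ∀ᵐ x, F z x ≤ a :=
        ⟨fun hz => (ENNReal.ae_le_essSup (F z)).mono fun x hx => hx.trans hz,
          fun hz => essSup_le_of_ae_le a hz⟩
      simp only [Set.mem_ofPred_eq, this, ae_iff, not_le, Set.preimage_ofPred_eq]
    change MeasurableSet {z | essSup (F z) volume ≤ a}
    rw [key]
    exact measurable_measure_prodMk_left (measurableSet_lt measurable_const hF)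
      (measurableSet_singleton 0)
  · exact (Measurable.lintegral_prod_right' (f := fun w : Z × EuclideanSpace ℝ (Fin n) =>
      F w.1 w.2 ^ p.toReal) (hF.pow_const _)).pow_const _

/-- Jensen's inequality with weight `M`, for `ℝ≥0∞`-valued integrands. -/
lemma lintegral_mul_rpow_le {Z : Type*} [MeasurableSpace Z] (ν : Measure Z) {r : ℝ} (hr : 1 ≤ r)
    {g M : Z → ℝ≥0∞} (hg : Measurable g) (hM : Measurable M) :
    (∫⁻ z, M z * g z ∂ν) ^ r ≤ (∫⁻ z, M z ∂ν) ^ (r - 1) * ∫⁻ z, M z * g z ^ r ∂ν := by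
  have hr0 : 0 < r := zero_lt_one.trans_le hr
  have h := eLpNorm'_le_eLpNorm'_mul_rpow_measure_univ (μ := ν.withDensity M) (f := g)
    (p := 1) (q := r) zero_lt_one hr hg.aestronglyMeasurable
  simp only [eLpNorm', enorm_eq_self, ENNReal.rpow_one, one_div, inv_one] at h
  rw [lintegral_withDensity_eq_lintegral_mul _ hM hg,
    lintegral_withDensity_eq_lintegral_mul _ hM (hg.pow_const r),
    withDensity_apply _ MeasurableSet.univ, Measure.restrict_univ] at h
  simp only [Pi.mul_apply] at h
  calc (∫⁻ z, M z * g z ∂ν) ^ r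
      ≤ ((∫⁻ z, M z * g z ^ r ∂ν) ^ r⁻¹ * (∫⁻ z, M z ∂ν) ^ (1 - r⁻¹)) ^ r := by gcongr
    _ = _ := by
      rw [ENNReal.mul_rpow_of_nonneg _ _ hr0.le, ENNReal.rpow_inv_rpow hr0.ne',
        ← ENNReal.rpow_mul, mul_comm, sub_mul, one_mul, inv_mul_cancel₀ hr0.ne']

/-- **Minkowski's integral inequality**. -/
lemma lpN_lintegral_le {Z : Type*} [MeasurableSpace Z] {ν : Measure Z} [SFinite ν] {p : ℝ≥0∞}
    (hp : 1 ≤ p) {F : EuclideanSpace ℝ (Fin n) → Z → ℝ≥0∞} (hF : Measurable (Function.uncurry F))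
    {M : Z → ℝ≥0∞} (hM : Measurable M) (h : ∀ z, lpN p (fun x => F x z) ≤ M z) :
    lpN p (fun x => ∫⁻ z, F x z ∂ν) ≤ ∫⁻ z, M z ∂ν := by
  have hMF : Measurable fun w : EuclideanSpace ℝ (Fin n) × Z => M w.2 := hM.comp measurable_snd
  have hF' : Measurable fun w : EuclideanSpace ℝ (Fin n) × Z => F w.1 w.2 := hF
  have hFz : ∀ z, Measurable fun x => F x z := fun z => hF'.comp measurable_prodMk_right
  by_cases hS : ∫⁻ z, M z ∂ν = ∞
  · simp [hS]
  by_cases hpt : p = ∞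
  · simp only [lpN, hpt, if_true] at h ⊢
    refine essSup_le_of_ae_le _ ?_
    have h1 : ∀ᵐ x, ∀ᵐ z ∂ν, F x z ≤ M z :=
      (Measure.ae_ae_comm (p := fun x z => F x z ≤ M z) (measurableSet_le hF' hMF)).2
        (Filter.Eventually.of_forall fun z =>
          (ENNReal.ae_le_essSup fun x => F x z).mono fun x hx => hx.trans (h z))
    exact h1.mono fun x hx => lintegral_mono_ae hx
  simp only [lpN, hpt, if_false] at h ⊢
  have hr : 1 ≤ p.toReal := by
    simpa using ENNReal.toReal_mono hpt hp
  set r := p.toReal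
  have hr0 : 0 < r := zero_lt_one.trans_le hr
  rw [ENNReal.rpow_inv_le_iff hr0]
  have h' : ∀ z, ∫⁻ x, F x z ^ r ≤ M z ^ r := fun z => (ENNReal.rpow_inv_le_iff hr0).1 (h z)
  have hfin : ∀ᵐ z ∂ν, M z < ∞ := ae_lt_top hM hS
  have h1 : ∀ᵐ x, ∀ᵐ z ∂ν, F x z ≤ M z * (F x z / M z) := by
    refine (Measure.ae_ae_comm (p := fun x z => F x z ≤ M z * (F x z / M z))
      (measurableSet_le hF' (hMF.mul (hF'.div hMF)))).2 ?_
    filter_upwards [hfin] with z hz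
    by_cases h0 : M z = 0
    · have hz0 : ∫⁻ x, F x z ^ r = 0 := by
        have := h' z
        rw [h0, ENNReal.zero_rpow_of_pos hr0] at this
        exact le_antisymm this bot_le
      rw [lintegral_eq_zero_iff ((hFz z).pow_const r)] at hz0
      filter_upwards [hz0] with x hx
      have : F x z = 0 := by simpa [hr0, hr0.not_gt] using hx
      simp [this]
    · exact Filter.Eventually.of_forall fun x => (ENNReal.mul_div_cancel h0 hz.ne).ge
  calc ∫⁻ x, (∫⁻ z, F x z ∂ν) ^ r
      ≤ ∫⁻ x, (∫⁻ z, M z ∂ν) ^ (r - 1) * ∫⁻ z, M z * (F x z / M z) ^ r ∂ν := by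
        refine lintegral_mono_ae (h1.mono fun x hx => ?_)
        refine le_trans (ENNReal.rpow_le_rpow (lintegral_mono_ae hx) hr0.le) ?_
        exact lintegral_mul_rpow_le ν hr ((hF'.comp measurable_prodMk_left).div hM) hM
    _ = (∫⁻ z, M z ∂ν) ^ (r - 1) * ∫⁻ z, (∫⁻ x, M z * (F x z / M z) ^ r) ∂ν := by
        rw [lintegral_const_mul' _ _ (ENNReal.rpow_ne_top_of_nonneg (by linarith) hS),
          lintegral_lintegral_swap (f := fun x z => M z * (F x z / M z) ^ r)]
        exact (hMF.mul ((hF'.div hMF).pow_const r)).aemeasurable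
    _ ≤ (∫⁻ z, M z ∂ν) ^ (r - 1) * ∫⁻ z, M z ∂ν := by
        refine mul_le_mul' le_rfl (lintegral_mono_ae (hfin.mono fun z hz => ?_))
        rw [lintegral_const_mul' _ _ hz.ne]
        simp_rw [div_eq_mul_inv, ENNReal.mul_rpow_of_nonneg _ _ hr0.le]
        rw [lintegral_mul_const _ ((hFz z).pow_const r)]
        calc M z * ((∫⁻ x, F x z ^ r) * (M z)⁻¹ ^ r) ≤ M z * (M z ^ r * (M z)⁻¹ ^ r) := by
              gcongr
              exact h' z
          _ ≤ M z * 1 := by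
              gcongr
              rw [← ENNReal.mul_rpow_of_nonneg _ _ hr0.le]
              exact ENNReal.rpow_le_one (ENNReal.mul_inv_le_one _) hr0.le
          _ = M z := mul_one _
    _ = (∫⁻ z, M z ∂ν) ^ r := by
        nth_rewrite 2 [← ENNReal.rpow_one (∫⁻ z, M z ∂ν)]
        rw [← ENNReal.rpow_add_of_nonneg _ _ (by linarith) zero_le_one, sub_add_cancel]

lemma lpN_ne_zero {p : ℝ≥0∞} {F : EuclideanSpace ℝ (Fin n) → ℝ≥0∞} (hF : Measurable F)
    (h : ∀ x, F x ≠ 0) : lpN p F ≠ 0 := by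
  unfold lpN
  split_ifs with hp
  · rw [ne_eq, ENNReal.essSup_eq_zero_iff]
    intro h0
    obtain ⟨x, hx⟩ := h0.exists
    exact h x hx
  · by_cases hr : p.toReal = 0
    · simp [hr]
    have hr0 : 0 < p.toReal := lt_of_le_of_ne ENNReal.toReal_nonneg (Ne.symm hr)
    rw [ne_eq, ENNReal.rpow_eq_zero_iff_of_pos (inv_pos.2 hr0),
      lintegral_eq_zero_iff (hF.pow_const _)]
    intro h0
    obtain ⟨x, hx⟩ := h0.exists
    exact h x (by simpa [hr0, hr0.not_gt] using hx)

lemma lpN_gaussian_ne_top {p : ℝ≥0∞} (hp : 1 ≤ p) {b : ℝ} (hb : 0 < b) :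
    lpN p (fun x : EuclideanSpace ℝ (Fin n) => ENNReal.ofReal (Real.exp (-b * ‖x‖ ^ 2))) ≠ ∞ := by
  unfold lpN
  split_ifs with h
  · refine ((essSup_le_of_ae_le 1 (Filter.Eventually.of_forall fun x => ?_)).trans_lt
      ENNReal.one_lt_top).ne
    rw [← ENNReal.ofReal_one]
    refine ENNReal.ofReal_le_ofReal (Real.exp_le_one_iff.2 ?_)
    nlinarith [sq_nonneg ‖x‖]
  · have hr : 0 < p.toReal := ENNReal.toReal_pos (zero_lt_one.trans_le hp).ne' h
    refine ENNReal.rpow_ne_top_of_nonneg (inv_nonneg.2 hr.le) ?_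
    have hi : Integrable fun x : EuclideanSpace ℝ (Fin n) =>
        Real.exp (-(b * p.toReal) * ‖x‖ ^ 2) := by
      have := (GaussianFourier.integrable_cexp_neg_mul_sq_norm_add
        (V := EuclideanSpace ℝ (Fin n)) (b := ((b * p.toReal : ℝ) : ℂ))
        (by simpa using mul_pos hb hr) 0 0).norm
      refine this.congr (Filter.Eventually.of_forall fun x => ?_)
      simp only [Complex.norm_exp, zero_mul, add_zero]
      congr 1
      norm_cast
    have := hi.lintegral_lt_top.ne
    convert this using 4 with x
    rw [ENNReal.ofReal_rpow_of_pos (Real.exp_pos _), ← Real.exp_mul]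
    congr 2
    ring

end MixedNorm

section GaussianIntegrals

variable {n : ℕ}

lemma integrable_gaussian_modulated {b : ℂ} (hb : 0 < b.re) (m w : EuclideanSpace ℝ (Fin n)) :
    Integrable fun v : EuclideanSpace ℝ (Fin n) =>
      Complex.exp (-b * (‖v - m‖ : ℂ) ^ 2 + Complex.I * (⟪w, v⟫ : ℝ)) := by
  have h := ((GaussianFourier.integrable_cexp_neg_mul_sq_norm_add hb Complex.I w).comp_sub_right
    m).mul_const (Complex.exp (Complex.I * (⟪w, m⟫ : ℝ)))
  refine h.congr (Filter.Eventually.of_forall fun v => ?_)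
  simp only [← Complex.exp_add, inner_sub_right]
  congr 1
  push_cast
  ring

lemma integral_gaussian_modulated {b : ℂ} (hb : 0 < b.re) (m w : EuclideanSpace ℝ (Fin n)) :
    ∫ v : EuclideanSpace ℝ (Fin n),
      Complex.exp (-b * (‖v - m‖ : ℂ) ^ 2 + Complex.I * (⟪w, v⟫ : ℝ)) =
    (π / b) ^ (n / 2 : ℂ) *
      Complex.exp (Complex.I * (⟪w, m⟫ : ℝ) - (‖w‖ : ℂ) ^ 2 / (4 * b)) := by
  have h := GaussianFourier.integral_cexp_neg_mul_sq_norm_add hb Complex.I w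
  rw [finrank_euclideanSpace_fin] at h
  rw [← integral_add_right_eq_self _ m]
  have : ∀ v : EuclideanSpace ℝ (Fin n),
      Complex.exp (-b * (‖v + m - m‖ : ℂ) ^ 2 + Complex.I * (⟪w, v + m⟫ : ℝ)) =
      Complex.exp (-b * (‖v‖ : ℂ) ^ 2 + Complex.I * (⟪w, v⟫ : ℝ)) *
        Complex.exp (Complex.I * (⟪w, m⟫ : ℝ)) := by
    intro v
    rw [← Complex.exp_add, inner_add_right, add_sub_cancel_right]
    congr 1
    push_cast
    ring
  simp_rw [this]
  rw [integral_mul_const, h, mul_assoc, ← Complex.exp_add, Complex.I_sq]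
  congr 2
  ring

/-- The short-time Fourier transform with Gaussian window, computed on the frequency side. -/
def freqSTFT (F : EuclideanSpace ℝ (Fin n) → ℂ) (x ξ : EuclideanSpace ℝ (Fin n)) : ℂ :=
  ∫ ζ, Complex.exp (Complex.I * (⟪x, ζ⟫ : ℝ)) * Complex.exp (-((‖ζ - ξ‖ : ℂ) ^ 2 / 4)) * F ζ

lemma measurable_freqSTFT {F : EuclideanSpace ℝ (Fin n) → ℂ} (hF : Continuous F) :
    Measurable fun w : EuclideanSpace ℝ (Fin n) × EuclideanSpace ℝ (Fin n) =>
      freqSTFT F w.1 w.2 := by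
  unfold freqSTFT
  refine (StronglyMeasurable.integral_prod_right (f := fun
    (w : EuclideanSpace ℝ (Fin n) × EuclideanSpace ℝ (Fin n)) (ζ : EuclideanSpace ℝ (Fin n)) =>
      Complex.exp (Complex.I * (⟪w.1, ζ⟫ : ℝ)) * Complex.exp (-((‖ζ - w.2‖ : ℂ) ^ 2 / 4)) * F ζ)
    (Continuous.stronglyMeasurable ?_)).measurable
  unfold Function.uncurry
  fun_prop

lemma stft_gauss_fourier_integral {F : EuclideanSpace ℝ (Fin n) → ℂ} (hF : Integrable F)
    (hFc : Continuous F) (c : ℂ) (x ξ : EuclideanSpace ℝ (Fin n)) :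
    STFT gauss (fun t => c * ∫ ζ, Complex.exp (Complex.I * (⟪t, ζ⟫ : ℝ)) * F ζ) x ξ =
      c * (π : ℂ) ^ (n / 2 : ℂ) * Complex.exp (-(Complex.I * (⟪x, ξ⟫ : ℝ))) * freqSTFT F x ξ := by
  have hgc : Continuous fun t : EuclideanSpace ℝ (Fin n) => gauss (t - x) := by
    unfold gauss
    fun_prop
  have hconj : ∀ t : EuclideanSpace ℝ (Fin n), (starRingEnd ℂ) (gauss (t - x)) = gauss (t - x) :=
    fun t => Complex.conj_ofReal _
  have hgauss : ∀ t : EuclideanSpace ℝ (Fin n),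
      gauss (t - x) = Complex.exp (-1 * (‖t - x‖ : ℂ) ^ 2) := fun t => by
    simp [gauss]
  have hgi : Integrable fun t : EuclideanSpace ℝ (Fin n) => gauss (t - x) := by
    have := integrable_gaussian_modulated (n := n) (b := 1) (by simp) x 0
    simpa [hgauss] using this
  set H : EuclideanSpace ℝ (Fin n) → EuclideanSpace ℝ (Fin n) → ℂ := fun t ζ =>
    Complex.exp (-(Complex.I * (⟪ξ, t⟫ : ℝ))) * gauss (t - x) *
      (Complex.exp (Complex.I * (⟪t, ζ⟫ : ℝ)) * F ζ) with hH
  have hHi : Integrable (Function.uncurry H) (volume.prod volume) := by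
    refine (hgi.norm.mul_prod hF.norm).mono' (Continuous.aestronglyMeasurable ?_)
      (Filter.Eventually.of_forall fun w => ?_)
    · simp only [H, hgauss]
      unfold Function.uncurry
      fun_prop
    · simp [H, Function.uncurry, Complex.norm_exp]
  have hin : ∀ ζ, ∫ t, H t ζ = (π : ℂ) ^ (n / 2 : ℂ) * Complex.exp (-(Complex.I * (⟪x, ξ⟫ : ℝ))) *
      (Complex.exp (Complex.I * (⟪x, ζ⟫ : ℝ)) * Complex.exp (-((‖ζ - ξ‖ : ℂ) ^ 2 / 4)) * F ζ) := by
    intro ζ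
    have h1 : ∀ t, H t ζ =
        Complex.exp (-1 * (‖t - x‖ : ℂ) ^ 2 + Complex.I * (⟪ζ - ξ, t⟫ : ℝ)) * F ζ := by
      intro t
      have h : Complex.I * ((⟪ζ - ξ, t⟫ : ℝ) : ℂ) =
          -(Complex.I * (⟪ξ, t⟫ : ℝ)) + Complex.I * (⟪t, ζ⟫ : ℝ) := by
        rw [inner_sub_left, real_inner_comm t ζ]
        push_cast
        ring
      simp only [H]
      rw [h, Complex.exp_add, Complex.exp_add, hgauss]
      ring
    simp_rw [h1]
    rw [integral_mul_const, integral_gaussian_modulated (by simp)]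
    have h : Complex.I * ((⟪ζ - ξ, x⟫ : ℝ) : ℂ) - (‖ζ - ξ‖ : ℂ) ^ 2 / (4 * 1) =
        -(Complex.I * (⟪x, ξ⟫ : ℝ)) + Complex.I * (⟪x, ζ⟫ : ℝ) +
          -((‖ζ - ξ‖ : ℂ) ^ 2 / 4) := by
      rw [inner_sub_left, real_inner_comm x ζ, real_inner_comm x ξ]
      push_cast
      ring
    rw [h, Complex.exp_add, Complex.exp_add, div_one]
    ring
  unfold STFT freqSTFT
  have h2 : ∀ t, Complex.exp (-(Complex.I * (⟪ξ, t⟫ : ℝ))) * (starRingEnd ℂ) (gauss (t - x)) *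
      (c * ∫ ζ, Complex.exp (Complex.I * (⟪t, ζ⟫ : ℝ)) * F ζ) = c * ∫ ζ, H t ζ := by
    intro t
    simp only [H]
    rw [integral_const_mul, hconj]
    ring
  simp_rw [h2]
  rw [integral_const_mul, integral_integral_swap hHi]
  simp_rw [hin]
  rw [integral_const_mul]
  ring

lemma stft_schrod {f : EuclideanSpace ℝ (Fin n) → ℂ} (hF : Integrable (FT f))
    (hFc : Continuous (FT f)) (ε : ℝ) (x ξ : EuclideanSpace ℝ (Fin n)) :
    ‖STFT gauss (schrod ε f) x ξ‖ₑ =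
      ENNReal.ofReal (((2 * π) ^ n)⁻¹ * ‖(π : ℂ) ^ (n / 2 : ℂ)‖) *
        ‖freqSTFT (fun ζ => Complex.exp (-(Complex.ofReal ε * Complex.I *
          Complex.ofReal (‖ζ‖ ^ 2))) * FT f ζ) x ξ‖ₑ := by
  have h := stft_gauss_fourier_integral (F := fun ζ => Complex.exp (-(Complex.ofReal ε *
    Complex.I * Complex.ofReal (‖ζ‖ ^ 2))) * FT f ζ) ?_ (by fun_prop)
    (((2 * π) ^ n)⁻¹ : ℝ) x ξ
  · have h1 : schrod ε f = fun t => ((((2 * π) ^ n)⁻¹ : ℝ) : ℂ) * ∫ ζ,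
        Complex.exp (Complex.I * (⟪t, ζ⟫ : ℝ)) * (Complex.exp (-(Complex.ofReal ε *
          Complex.I * Complex.ofReal (‖ζ‖ ^ 2))) * FT f ζ) := by
      funext t
      simp only [schrod, mul_assoc]
    rw [h1, h, enorm_mul]
    congr 1
    rw [← ofReal_norm]
    congr 1
    simp [Complex.norm_exp, abs_of_pos Real.pi_pos]
  · refine hF.norm.mono' (Continuous.aestronglyMeasurable (by fun_prop))
      (Filter.Eventually.of_forall fun ζ => ?_)
    simp [Complex.norm_exp, -Complex.ofReal_pow]

end GaussianIntegrals

section KernelBound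

variable {n : ℕ}

/-- The Gaussian weight dominating the kernel of `e^{iΔ}` on the phase space. -/
def kernelWeight (z : EuclideanSpace ℝ (Fin n) × EuclideanSpace ℝ (Fin n)) : ℝ :=
  Real.exp (-(‖z.1‖ ^ 2 / 8)) * Real.exp (-(‖z.2‖ ^ 2 / 10))

lemma integrable_kernelWeight : Integrable (kernelWeight (n := n)) := by
  have key : ∀ b : ℝ, 0 < b →
      Integrable fun v : EuclideanSpace ℝ (Fin n) => Real.exp (-(b * ‖v‖ ^ 2)) := by
    intro b hb
    have := (integrable_gaussian_modulated (n := n) (b := b) (by simpa using hb) 0 0).norm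
    simpa [Complex.norm_exp, ← Complex.ofReal_pow] using this
  have h := (key (1 / 8) (by norm_num)).mul_prod (key (1 / 10) (by norm_num))
  refine h.congr (Filter.Eventually.of_forall fun z => ?_)
  simp only [kernelWeight]
  congr 2 <;> ring

/-- The exponent of the kernel representing `e^{iΔ}` on the phase space. -/
def kernelPhase (b : ℂ) (x ξ ζ η y : EuclideanSpace ℝ (Fin n)) : ℂ :=
  -((‖η‖ : ℂ) ^ 2 / 8) - b * (‖y‖ : ℂ) ^ 2 +
    Complex.I * (⟪ξ - (1 / 2 : ℝ) • η, y + ξ - (1 / 2 : ℝ) • η⟫ : ℝ) +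
    Complex.I * (⟪x - (y + (2 : ℝ) • ξ - η), ζ⟫ : ℝ) - (‖ζ - (ξ - η)‖ : ℂ) ^ 2 / 4

lemma ofReal_norm_sq_eq_inner (v : EuclideanSpace ℝ (Fin n)) :
    (‖v‖ : ℂ) ^ 2 = ((⟪v, v⟫ : ℝ) : ℂ) := by
  rw [real_inner_self_eq_norm_sq]
  push_cast
  rfl

lemma integral_kernelPhase_snd {b : ℂ} (hb : 0 < b.re) (x ξ ζ η : EuclideanSpace ℝ (Fin n)) :
    ∫ y, Complex.exp (kernelPhase b x ξ ζ η y) = (π / b) ^ (n / 2 : ℂ) *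
      Complex.exp (-(‖ξ - (1 / 2 : ℝ) • η - ζ‖ : ℂ) ^ 2 / (4 * b) + kernelPhase b x ξ ζ η 0) := by
  have h : ∀ y, Complex.exp (kernelPhase b x ξ ζ η y) =
      Complex.exp (-b * (‖y - 0‖ : ℂ) ^ 2 + Complex.I * (⟪ξ - (1 / 2 : ℝ) • η - ζ, y⟫ : ℝ)) *
        Complex.exp (kernelPhase b x ξ ζ η 0) := by
    intro y
    rw [← Complex.exp_add]
    congr 1
    simp only [kernelPhase, sub_zero, norm_zero, inner_sub_left, inner_sub_right, inner_add_left,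
      inner_add_right, inner_zero_left, inner_zero_right, real_inner_smul_left,
      real_inner_smul_right]
    rw [real_inner_comm y ζ]
    push_cast
    ring
  rw [integral_congr_ae (Filter.Eventually.of_forall h), integral_mul_const,
    integral_gaussian_modulated hb, mul_assoc, ← Complex.exp_add]
  congr 2
  rw [inner_zero_right]
  push_cast
  ring

lemma kernelPhase_complete_square {b : ℂ} (hb : 1 / (4 * b) = 1 / 2 + Complex.I)
    (x ξ ζ η : EuclideanSpace ℝ (Fin n)) :
    -(‖ξ - (1 / 2 : ℝ) • η - ζ‖ : ℂ) ^ 2 / (4 * b) + kernelPhase b x ξ ζ η 0 =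
      (-((1 / 2 : ℝ) : ℂ) * (‖η - (ξ - ζ)‖ : ℂ) ^ 2 +
        Complex.I * (⟪(0 : EuclideanSpace ℝ (Fin n)), η⟫ : ℝ)) +
      (Complex.I * (⟪x, ζ⟫ : ℝ) - (‖ζ - ξ‖ : ℂ) ^ 2 / 4 - Complex.I * (‖ζ‖ : ℂ) ^ 2) := by
  rw [div_eq_mul_one_div, hb]
  simp only [kernelPhase, ofReal_norm_sq_eq_inner, norm_zero, inner_sub_left, inner_sub_right,
    inner_add_left, inner_add_right, inner_zero_left, inner_zero_right, real_inner_smul_left,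
    real_inner_smul_right]
  rw [real_inner_comm ξ ζ, real_inner_comm η ζ, real_inner_comm ξ η]
  push_cast
  ring

lemma norm_exp_kernelPhase (x ξ ζ : EuclideanSpace ℝ (Fin n)) {b : ℂ} (hb : b.re = 1 / 10)
    (z : EuclideanSpace ℝ (Fin n) × EuclideanSpace ℝ (Fin n)) :
    ‖Complex.exp (kernelPhase b x ξ ζ z.1 z.2)‖ =
      kernelWeight z * Real.exp (-(‖ζ - (ξ - z.1)‖ ^ 2 / 4)) := by
  rw [Complex.norm_exp, kernelWeight, ← Real.exp_add, ← Real.exp_add]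
  congr 1
  have h8 : ((‖z.1‖ : ℂ) ^ 2 / 8) = ((‖z.1‖ ^ 2 / 8 : ℝ) : ℂ) := by push_cast; rfl
  have h4 : ((‖ζ - (ξ - z.1)‖ : ℂ) ^ 2 / 4) = ((‖ζ - (ξ - z.1)‖ ^ 2 / 4 : ℝ) : ℂ) := by
    push_cast; rfl
  have hy : (‖z.2‖ : ℂ) ^ 2 = ((‖z.2‖ ^ 2 : ℝ) : ℂ) := by push_cast; rfl
  rw [kernelPhase, h8, h4, hy]
  simp only [Complex.add_re, Complex.sub_re, Complex.neg_re, Complex.ofReal_re,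
    Complex.re_mul_ofReal,    Complex.I_re, hb]
  ring

lemma exists_enorm_freqSTFT_le :
    ∃ C : ℝ≥0∞, C ≠ ∞ ∧ ∀ F : EuclideanSpace ℝ (Fin n) → ℂ, Integrable F → Continuous F →
      ∀ x ξ, ‖freqSTFT (fun ζ => Complex.exp (-(Complex.ofReal 1 * Complex.I *
        Complex.ofReal (‖ζ‖ ^ 2))) * F ζ) x ξ‖ₑ ≤
      C * ∫⁻ z : EuclideanSpace ℝ (Fin n) × EuclideanSpace ℝ (Fin n),
        ENNReal.ofReal (kernelWeight z) *
          ‖freqSTFT F (x - (z.2 + (2 : ℝ) • ξ - z.1)) (ξ - z.1)‖ₑ := by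
  set b : ℂ := (1 / 2 - Complex.I) / 5 with hbdef
  have hbre : b.re = 1 / 10 := by simp [hbdef]; norm_num
  have hb0 : 0 < b.re := by rw [hbre]; norm_num
  have hbne : b ≠ 0 := fun h => by simp [h] at hb0
  have hb : 1 / (4 * b) = 1 / 2 + Complex.I := by
    rw [div_eq_iff (mul_ne_zero (by norm_num) hbne), hbdef]
    linear_combination (4 / 5 : ℂ) * Complex.I_sq
  set c : ℂ := (π / b) ^ (n / 2 : ℂ) * (π / ((1 / 2 : ℝ) : ℂ)) ^ (n / 2 : ℂ) with hc
  have hc0 : c ≠ 0 := by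
    have hpi : (π : ℂ) ≠ 0 := by exact_mod_cast Real.pi_ne_zero
    refine mul_ne_zero ?_ ?_ <;> rw [Ne, Complex.cpow_eq_zero_iff] <;> simp [hpi, hbne]
  refine ⟨‖c‖ₑ⁻¹, by simpa using hc0, fun F hF hFc x ξ => ?_⟩
  set k : EuclideanSpace ℝ (Fin n) → EuclideanSpace ℝ (Fin n) × EuclideanSpace ℝ (Fin n) → ℂ :=
    fun ζ z => Complex.exp (kernelPhase b x ξ ζ z.1 z.2) * F ζ with hk
  have hphase : Continuous fun w : EuclideanSpace ℝ (Fin n) ×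
      (EuclideanSpace ℝ (Fin n) × EuclideanSpace ℝ (Fin n)) =>
      Complex.exp (kernelPhase b x ξ w.1 w.2.1 w.2.2) := by
    unfold kernelPhase
    fun_prop
  have hle : ∀ ζ z, ‖Complex.exp (kernelPhase b x ξ ζ z.1 z.2)‖ ≤ kernelWeight z := by
    intro ζ z
    rw [norm_exp_kernelPhase x ξ ζ hbre]
    refine mul_le_of_le_one_right (by unfold kernelWeight; positivity) ?_
    rw [Real.exp_le_one_iff]
    exact neg_nonpos.2 (by positivity)
  have hki : Integrable (Function.uncurry k) (volume.prod volume) := by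
    refine (hF.norm.mul_prod integrable_kernelWeight).mono' (Continuous.aestronglyMeasurable ?_)
      (Filter.Eventually.of_forall fun w => ?_)
    · exact hphase.mul (hFc.comp continuous_fst)
    · simp only [Function.uncurry, k, norm_mul]
      rw [mul_comm]
      exact mul_le_mul_of_nonneg_left (hle _ _) (norm_nonneg _)
  have hphase_int : ∀ ζ, Integrable fun z : EuclideanSpace ℝ (Fin n) × EuclideanSpace ℝ (Fin n) =>
      Complex.exp (kernelPhase b x ξ ζ z.1 z.2) := fun ζ =>
    integrable_kernelWeight.mono' (hphase.comp (by fun_prop :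
      Continuous fun z : EuclideanSpace ℝ (Fin n) × EuclideanSpace ℝ (Fin n) =>
        (ζ, z))).aestronglyMeasurable (Filter.Eventually.of_forall (hle ζ))
  have hkz : ∀ ζ, ∫ z, k ζ z = c * (Complex.exp (Complex.I * (⟪x, ζ⟫ : ℝ)) *
      Complex.exp (-((‖ζ - ξ‖ : ℂ) ^ 2 / 4)) *
      (Complex.exp (-(Complex.ofReal 1 * Complex.I * Complex.ofReal (‖ζ‖ ^ 2))) * F ζ)) := by
    intro ζ
    simp only [k]
    rw [integral_mul_const, Measure.volume_eq_prod, integral_prod _ (hphase_int ζ)]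
    simp only [integral_kernelPhase_snd hb0, kernelPhase_complete_square hb]
    simp_rw [Complex.exp_add _ (Complex.I * (⟪x, ζ⟫ : ℝ) - (‖ζ - ξ‖ : ℂ) ^ 2 / 4 -
      Complex.I * (‖ζ‖ : ℂ) ^ 2)]
    rw [integral_const_mul, integral_mul_const, integral_gaussian_modulated (by simp)]
    have : Complex.I * (⟪x, ζ⟫ : ℝ) - (‖ζ - ξ‖ : ℂ) ^ 2 / 4 - Complex.I * (‖ζ‖ : ℂ) ^ 2 =
        Complex.I * (⟪x, ζ⟫ : ℝ) + -((‖ζ - ξ‖ : ℂ) ^ 2 / 4) +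
          -(Complex.ofReal 1 * Complex.I * Complex.ofReal (‖ζ‖ ^ 2)) := by
      push_cast
      ring
    rw [this, Complex.exp_add, Complex.exp_add, hc]
    simp only [inner_zero_left, norm_zero, Complex.ofReal_zero, mul_zero, ne_eq,
      OfNat.ofNat_ne_zero, not_false_eq_true, zero_pow, zero_div, sub_zero, Complex.exp_zero,
      mul_one]
    ring
  have hkζ : ∀ z, ‖∫ ζ, k ζ z‖ₑ = ENNReal.ofReal (kernelWeight z) *
      ‖freqSTFT F (x - (z.2 + (2 : ℝ) • ξ - z.1)) (ξ - z.1)‖ₑ := by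
    intro z
    have h : ∀ ζ, k ζ z = Complex.exp (kernelPhase b x ξ (ξ - z.1) z.1 z.2 -
        Complex.I * (⟪x - (z.2 + (2 : ℝ) • ξ - z.1), ξ - z.1⟫ : ℝ)) *
        (Complex.exp (Complex.I * (⟪x - (z.2 + (2 : ℝ) • ξ - z.1), ζ⟫ : ℝ)) *
          Complex.exp (-((‖ζ - (ξ - z.1)‖ : ℂ) ^ 2 / 4)) * F ζ) := by
      intro ζ
      simp only [k]
      rw [← mul_assoc, ← mul_assoc, ← Complex.exp_add, ← Complex.exp_add]
      congr 2
      simp only [kernelPhase, sub_self, norm_zero]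
      push_cast
      ring
    simp_rw [h]
    rw [integral_const_mul, enorm_mul, ← ofReal_norm, sub_eq_add_neg, Complex.exp_add, norm_mul,
      norm_exp_kernelPhase x ξ _ hbre]
    simp [Complex.norm_exp, freqSTFT]
  have hswap := integral_integral_swap hki
  simp_rw [hkz] at hswap
  rw [integral_const_mul] at hswap
  rw [mul_comm ‖c‖ₑ⁻¹, ← div_eq_mul_inv, ENNReal.le_div_iff_mul_le (by simp [hc0]) (by simp), mul_comm,
    ← enorm_mul]
  unfold freqSTFT at hkζ ⊢
  rw [hswap]
  refine (enorm_integral_le_lintegral_enorm _).trans (le_of_eq ?_)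
  exact lintegral_congr fun z => hkζ z

end KernelBound

section Boundedness

open scoped FourierTransform

variable {n : ℕ}

lemma measurable_lpN_freqSTFT {p : ℝ≥0∞} {F : EuclideanSpace ℝ (Fin n) → ℂ}
    (hFc : Continuous F) : Measurable fun ξ => lpN p fun x => ‖freqSTFT F x ξ‖ₑ := by
  have h := (measurable_freqSTFT hFc).enorm.comp measurable_swap
  exact measurable_lpN h

lemma measurable_ofReal_kernelWeight :
    Measurable fun z : EuclideanSpace ℝ (Fin n) × EuclideanSpace ℝ (Fin n) =>
      ENNReal.ofReal (kernelWeight z) := by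
  unfold kernelWeight
  fun_prop

lemma measurable_kernel_mul_freqSTFT {F : EuclideanSpace ℝ (Fin n) → ℂ} (hFc : Continuous F)
    (ξ : EuclideanSpace ℝ (Fin n)) :
    Measurable (Function.uncurry fun (x : EuclideanSpace ℝ (Fin n))
      (z : EuclideanSpace ℝ (Fin n) × EuclideanSpace ℝ (Fin n)) =>
        ENNReal.ofReal (kernelWeight z) *
          ‖freqSTFT F (x - (z.2 + (2 : ℝ) • ξ - z.1)) (ξ - z.1)‖ₑ) := by
  have hshift : Measurable fun w : EuclideanSpace ℝ (Fin n) ×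
      (EuclideanSpace ℝ (Fin n) × EuclideanSpace ℝ (Fin n)) =>
        (w.1 - (w.2.2 + (2 : ℝ) • ξ - w.2.1), ξ - w.2.1) := by
    fun_prop
  have h1 : Measurable fun w : EuclideanSpace ℝ (Fin n) ×
      (EuclideanSpace ℝ (Fin n) × EuclideanSpace ℝ (Fin n)) => ENNReal.ofReal (kernelWeight w.2) :=
    measurable_ofReal_kernelWeight.comp measurable_snd
  have h2 := (measurable_freqSTFT hFc).enorm.comp hshift
  simp only [Function.comp_def] at h2
  unfold Function.uncurry
  exact h1.mul h2

lemma exists_lpN_freqSTFT_le {p q : ℝ≥0∞} (hp : 1 ≤ p) (hq : 1 ≤ q) :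
    ∃ C : ℝ≥0∞, C ≠ ∞ ∧ ∀ F : EuclideanSpace ℝ (Fin n) → ℂ, Integrable F → Continuous F →
      lpN q (fun ξ => lpN p fun x => ‖freqSTFT (fun ζ => Complex.exp (-(Complex.ofReal 1 *
        Complex.I * Complex.ofReal (‖ζ‖ ^ 2))) * F ζ) x ξ‖ₑ) ≤
      C * lpN q (fun ξ => lpN p fun x => ‖freqSTFT F x ξ‖ₑ) := by
  obtain ⟨C, hC, h⟩ := exists_enorm_freqSTFT_le (n := n)
  have hw : ∫⁻ z : EuclideanSpace ℝ (Fin n) × EuclideanSpace ℝ (Fin n),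
      ENNReal.ofReal (kernelWeight z) ≠ ∞ := integrable_kernelWeight.lintegral_lt_top.ne
  have hwm := measurable_ofReal_kernelWeight (n := n)
  refine ⟨C * ∫⁻ z, ENNReal.ofReal (kernelWeight (n := n) z), ENNReal.mul_ne_top hC hw,
    fun F hF hFc => ?_⟩
  obtain ⟨N, hN⟩ : ∃ N : EuclideanSpace ℝ (Fin n) → ℝ≥0∞,
      N = fun ξ => lpN p fun x => ‖freqSTFT F x ξ‖ₑ := ⟨_, rfl⟩
  have hNm : Measurable N := hN ▸ measurable_lpN_freqSTFT hFc
  have hinner : ∀ ξ, lpN p (fun x => ‖freqSTFT (fun ζ => Complex.exp (-(Complex.ofReal 1 *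
      Complex.I * Complex.ofReal (‖ζ‖ ^ 2))) * F ζ) x ξ‖ₑ) ≤
      C * ∫⁻ z : EuclideanSpace ℝ (Fin n) × EuclideanSpace ℝ (Fin n),
        ENNReal.ofReal (kernelWeight z) * N (ξ - z.1) := by
    intro ξ
    refine (lpN_mono fun x => h F hF hFc x ξ).trans ?_
    rw [lpN_const_mul hp hC]
    gcongr
    have hshift : Measurable fun z : EuclideanSpace ℝ (Fin n) × EuclideanSpace ℝ (Fin n) =>
      ξ - z.1 := by fun_prop
    refine lpN_lintegral_le hp (measurable_kernel_mul_freqSTFT hFc ξ)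
      (hwm.mul (hNm.comp hshift)) fun z => ?_
    rw [lpN_const_mul hp ENNReal.ofReal_ne_top, hN]
    gcongr
    simp only [sub_eq_add_neg _ (z.2 + (2 : ℝ) • ξ - z.1)]
    exact (lpN_comp_add_right p (fun x => ‖freqSTFT F x (ξ - z.1)‖ₑ) _).le
  rw [← hN]
  refine (lpN_mono hinner).trans ?_
  rw [lpN_const_mul hq hC, mul_assoc, ← lintegral_mul_const _ hwm]
  gcongr
  have hshift : Measurable fun w : EuclideanSpace ℝ (Fin n) ×
      (EuclideanSpace ℝ (Fin n) × EuclideanSpace ℝ (Fin n)) => w.1 - w.2.1 := by fun_prop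
  refine lpN_lintegral_le hq (F := fun ξ z => ENNReal.ofReal (kernelWeight z) * N (ξ - z.1))
    (M := fun z => ENNReal.ofReal (kernelWeight z) * lpN q N)
    ((hwm.comp measurable_snd).mul (hNm.comp hshift)) (hwm.mul_const _) fun z => ?_
  rw [lpN_const_mul hq ENNReal.ofReal_ne_top]
  gcongr
  simp only [sub_eq_add_neg]
  exact (lpN_comp_add_right q N _).le

lemma FT_schwartz (f : SchwartzMap (EuclideanSpace ℝ (Fin n)) ℂ) :
    FT f = fun ζ => (𝓕 f : SchwartzMap (EuclideanSpace ℝ (Fin n)) ℂ) ((2 * π)⁻¹ • ζ) := by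
  funext ζ
  rw [SchwartzMap.fourier_coe, Real.fourier_eq']
  refine integral_congr_ae (Filter.Eventually.of_forall fun x => ?_)
  simp only [smul_eq_mul, real_inner_smul_right]
  congr 2
  rw [real_inner_comm ζ x]
  push_cast
  field_simp

lemma continuous_FT_schwartz (f : SchwartzMap (EuclideanSpace ℝ (Fin n)) ℂ) :
    Continuous (FT f) := by
  rw [FT_schwartz]
  exact (SchwartzMap.continuous _).comp (by fun_prop)

lemma integrable_FT_schwartz (f : SchwartzMap (EuclideanSpace ℝ (Fin n)) ℂ) :
    Integrable (FT f) := by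
  rw [FT_schwartz]
  exact (SchwartzMap.integrable _).comp_smul (by positivity)

lemma schrod_zero_schwartz (f : SchwartzMap (EuclideanSpace ℝ (Fin n)) ℂ) :
    schrod 0 f = f := by
  funext x
  have h : (𝓕⁻ (𝓕 f) : SchwartzMap (EuclideanSpace ℝ (Fin n)) ℂ) x = f x := by
    rw [FourierTransform.fourierInv_fourier_eq]
  rw [SchwartzMap.fourierInv_coe, Real.fourierInv_eq'] at h
  rw [← h]
  have h2 := Measure.integral_comp_inv_smul_of_nonneg (volume : Measure (EuclideanSpace ℝ (Fin n)))
    (fun v => Complex.exp (((2 * π * ⟪v, x⟫ : ℝ) : ℂ) * Complex.I) •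
      (𝓕 f : SchwartzMap (EuclideanSpace ℝ (Fin n)) ℂ) v) (R := 2 * π) (by positivity)
  rw [finrank_euclideanSpace_fin] at h2
  have h3 : ∀ ζ, Complex.exp (Complex.I * Complex.ofReal ⟪x, ζ⟫) *
      Complex.exp (-(Complex.ofReal 0 * Complex.I * Complex.ofReal (‖ζ‖ ^ 2))) * FT f ζ =
      Complex.exp (((2 * π * ⟪(2 * π)⁻¹ • ζ, x⟫ : ℝ) : ℂ) * Complex.I) •
      (𝓕 f : SchwartzMap (EuclideanSpace ℝ (Fin n)) ℂ) ((2 * π)⁻¹ • ζ) := by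
    intro ζ
    have h4 : 2 * π * ((2 * π)⁻¹ * ⟪x, ζ⟫) = ⟪x, ζ⟫ := by
      field_simp
    rw [real_inner_smul_left, real_inner_comm x ζ, h4, FT_schwartz]
    simp [mul_comm]
  unfold schrod
  simp_rw [h3]
  rw [h2, Complex.real_smul, ← mul_assoc, ← Complex.ofReal_mul, inv_mul_cancel₀ (by positivity)]
  simp

lemma MNorm_schrod_eq {p q : ℝ≥0∞} (hp : 1 ≤ p) (hq : 1 ≤ q) (s ε : ℝ)
    (f : SchwartzMap (EuclideanSpace ℝ (Fin n)) ℂ) :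
    MNorm s p q (schrod ε f) = ENNReal.ofReal (((2 * π) ^ n)⁻¹ * ‖(π : ℂ) ^ (n / 2 : ℂ)‖) *
      lpN q (fun ξ => ENNReal.ofReal (jp s ξ) * lpN p (fun x => ‖freqSTFT (fun ζ =>
        Complex.exp (-(Complex.ofReal ε * Complex.I * Complex.ofReal (‖ζ‖ ^ 2))) *
          FT f ζ) x ξ‖ₑ)) := by
  unfold MNorm
  rw [← lpN_const_mul hq ENNReal.ofReal_ne_top]
  congr 1
  funext ξ
  rw [← mul_assoc, ← lpN_const_mul hp (ENNReal.mul_ne_top ENNReal.ofReal_ne_top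
    ENNReal.ofReal_ne_top)]
  congr 1
  funext x
  rw [← enorm_eq_nnnorm, stft_schrod (integrable_FT_schwartz f) (continuous_FT_schwartz f)]
  ring

lemma jp_zero (x : EuclideanSpace ℝ (Fin n)) : jp 0 x = 1 := by
  simp [jp]

lemma MNorm_mono_weight {s : ℝ} (hs : 0 ≤ s) (p q : ℝ≥0∞) (f : EuclideanSpace ℝ (Fin n) → ℂ) :
    MNorm 0 p q f ≤ MNorm s p q f := by
  refine lpN_mono fun ξ => lpN_mono fun x => ?_
  gcongr
  rw [jp_zero]
  exact Real.one_le_rpow (by nlinarith [sq_nonneg ‖ξ‖]) (by positivity)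

lemma exists_MNorm_schrod_le {s : ℝ} (hs : 0 ≤ s) {p q : ℝ≥0∞} (hp : 1 ≤ p) (hq : 1 ≤ q) :
    ∃ C : ℝ, 0 < C ∧ ∀ f : SchwartzMap (EuclideanSpace ℝ (Fin n)) ℂ,
      MNorm 0 p q (schrod 1 ⇑f) ≤ ENNReal.ofReal C * MNorm s p q ⇑f := by
  obtain ⟨C, hC, h⟩ := exists_lpN_freqSTFT_le (n := n) hp hq
  refine ⟨C.toReal + 1, by positivity, fun f => ?_⟩
  calc MNorm 0 p q (schrod 1 ⇑f) ≤ C * MNorm 0 p q (schrod 0 ⇑f) := by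
        rw [MNorm_schrod_eq hp hq, MNorm_schrod_eq hp hq, mul_left_comm]
        gcongr
        simpa [jp_zero] using h _ (integrable_FT_schwartz f) (continuous_FT_schwartz f)
    _ ≤ ENNReal.ofReal (C.toReal + 1) * MNorm s p q f := by
        rw [schrod_zero_schwartz]
        gcongr
        · rw [ENNReal.le_ofReal_iff_toReal_le hC (by positivity)]
          simp
        · exact MNorm_mono_weight hs p q f

end Boundedness

section GaussianSchwartz

open scoped FourierTransform

variable {n : ℕ}

lemma one_add_pow_mul_exp_le {a : ℝ} (ha : 0 < a) (k : ℕ) {t : ℝ} (ht : 0 ≤ t) :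
    (1 + t) ^ k * Real.exp (-(a * t ^ 2)) ≤ k.factorial * a⁻¹ ^ k * Real.exp (2 * a) := by
  have h := Real.pow_div_factorial_le_exp (a * (1 + t)) (by positivity) k
  rw [div_le_iff₀ (by positivity), mul_pow] at h
  have h2 : a * (1 + t) ≤ 2 * a + a * t ^ 2 := by nlinarith [sq_nonneg (t - 1)]
  have h3 : Real.exp (a * (1 + t)) ≤ Real.exp (2 * a) * Real.exp (a * t ^ 2) := by
    rw [← Real.exp_add]
    exact Real.exp_le_exp.2 h2
  have h4 : (1 + t) ^ k ≤ a⁻¹ ^ k * (Real.exp (2 * a) * Real.exp (a * t ^ 2) * k.factorial) := by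
    rw [inv_pow, ← div_eq_inv_mul, le_div_iff₀ (by positivity), mul_comm]
    exact h.trans (by gcongr)
  rw [Real.exp_neg, ← div_eq_mul_inv, div_le_iff₀ (by positivity)]
  linarith

lemma norm_iteratedFDeriv_exp (k : ℕ) (y : ℝ) :
    ‖iteratedFDeriv ℝ k Real.exp y‖ = Real.exp y := by
  rw [norm_iteratedFDeriv_eq_norm_iteratedDeriv, iteratedDeriv_eq_iterate, Real.iter_deriv_exp,
    Real.norm_eq_abs, Real.abs_exp]

lemma decay_gaussian {a : ℝ} (ha : 0 < a) (k m : ℕ) :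
    ∃ C : ℝ, ∀ x : EuclideanSpace ℝ (Fin n),
      ‖x‖ ^ k * ‖iteratedFDeriv ℝ m (Real.exp ∘ fun x => -a * ‖x‖ ^ 2) x‖ ≤ C := by
  have htemp : (fun x : EuclideanSpace ℝ (Fin n) => -a * ‖x‖ ^ 2).HasTemperateGrowth :=
    (Function.HasTemperateGrowth.const (-a)).mul (Function.hasTemperateGrowth_norm_sq _)
  obtain ⟨l, C, hC, h⟩ := htemp.norm_iteratedFDeriv_le_uniform m
  refine ⟨m.factorial * (1 + C) ^ m * ((k + l * m).factorial * a⁻¹ ^ (k + l * m) *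
    Real.exp (2 * a)), fun x => ?_⟩
  have hx : 1 ≤ 1 + ‖x‖ := by simp
  have hD : ∀ i, 1 ≤ i → i ≤ m → ‖iteratedFDeriv ℝ i (fun x : EuclideanSpace ℝ (Fin n) =>
      -a * ‖x‖ ^ 2) x‖ ≤ ((1 + C) * (1 + ‖x‖) ^ l) ^ i := by
    intro i hi him
    have h1 : C * (1 + ‖x‖) ^ l ≤ (1 + C) * (1 + ‖x‖) ^ l := by gcongr; linarith
    exact ((h i him x).trans h1).trans (le_self_pow₀
      (one_le_mul_of_one_le_of_one_le (by linarith) (one_le_pow₀ hx)) (by omega))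
  have hcomp := norm_iteratedFDeriv_comp_le (n := m) (N := m) Real.contDiff_exp
    (htemp.1.of_le (mod_cast le_top)) le_rfl x (fun i _ => (norm_iteratedFDeriv_exp i _).le) hD
  calc ‖x‖ ^ k * ‖iteratedFDeriv ℝ m (Real.exp ∘ fun x => -a * ‖x‖ ^ 2) x‖
      ≤ (1 + ‖x‖) ^ k * (m.factorial * Real.exp (-a * ‖x‖ ^ 2) *
        ((1 + C) * (1 + ‖x‖) ^ l) ^ m) := by
        gcongr
        linarith
    _ = m.factorial * (1 + C) ^ m * ((1 + ‖x‖) ^ (k + l * m) * Real.exp (-(a * ‖x‖ ^ 2))) := by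
        rw [mul_pow, ← pow_mul, pow_add, neg_mul]
        ring
    _ ≤ _ := by
        exact mul_le_mul_of_nonneg_left (one_add_pow_mul_exp_le ha _ (norm_nonneg x))
          (by positivity)

/-- The Gaussian `x ↦ e^{-a|x|²}` as a Schwartz function. -/
def gaussianSchwartz {a : ℝ} (ha : 0 < a) : SchwartzMap (EuclideanSpace ℝ (Fin n)) ℝ where
  toFun := Real.exp ∘ fun x => -a * ‖x‖ ^ 2
  smooth' := Real.contDiff_exp.comp (contDiff_const.mul (contDiff_norm_sq ℝ))
  decay' := decay_gaussian ha

lemma exists_schwartz_FT_eq_gaussian (N : EuclideanSpace ℝ (Fin n)) :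
    ∃ f : SchwartzMap (EuclideanSpace ℝ (Fin n)) ℂ,
      FT f = fun ζ => Complex.exp (-((‖ζ - N‖ : ℂ) ^ 2 / 4)) := by
  have hpi : 0 < π ^ 2 := by positivity
  set G : SchwartzMap (EuclideanSpace ℝ (Fin n)) ℂ :=
    ((gaussianSchwartz hpi).postcompCLM Complex.ofRealCLM).compSubConstCLM ℝ ((2 * π)⁻¹ • N) with hG
  refine ⟨𝓕⁻ G, ?_⟩
  rw [FT_schwartz, FourierTransform.fourier_fourierInv_eq]
  funext ζ
  have h1 : -π ^ 2 * ‖(2 * π)⁻¹ • ζ - (2 * π)⁻¹ • N‖ ^ 2 = -(‖ζ - N‖ ^ 2 / 4) := by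
    rw [← smul_sub, norm_smul, Real.norm_of_nonneg (by positivity)]
    field_simp
    ring
  have h2 : G ((2 * π)⁻¹ • ζ) =
      ((Real.exp (-π ^ 2 * ‖(2 * π)⁻¹ • ζ - (2 * π)⁻¹ • N‖ ^ 2) : ℝ) : ℂ) := rfl
  rw [h2, h1]
  push_cast
  rfl

end GaussianSchwartz

section Sharpness

variable {n : ℕ}

lemma norm_freqSTFT_gaussian (ε : ℝ) (N x ξ : EuclideanSpace ℝ (Fin n)) :
    ‖freqSTFT (fun ζ => Complex.exp (-(Complex.ofReal ε * Complex.I * Complex.ofReal (‖ζ‖ ^ 2))) *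
      Complex.exp (-((‖ζ - N‖ : ℂ) ^ 2 / 4))) x ξ‖ =
    ‖(π / (1 / 2 + ε * Complex.I) : ℂ) ^ (n / 2 : ℂ)‖ * Real.exp (-(1 / 8) * ‖ξ - N‖ ^ 2) *
      Real.exp (-(1 / (2 * (1 + 4 * ε ^ 2))) * ‖x - ε • (ξ + N)‖ ^ 2) := by
  set a : ℂ := 1 / 2 + ε * Complex.I with ha
  have hare : 0 < a.re := by simp [ha]
  have ha0 : a ≠ 0 := fun h => by simp [h] at hare
  have hr : 1 / (4 * a) = ((1 / (2 * (1 + 4 * ε ^ 2)) : ℝ) : ℂ) -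
      ((ε / (1 + 4 * ε ^ 2) : ℝ) : ℂ) * Complex.I := by
    have hε : (1 + 4 * (ε : ℂ) ^ 2) ≠ 0 := by
      exact_mod_cast (by positivity : (1 + 4 * ε ^ 2) ≠ 0)
    rw [div_eq_iff (mul_ne_zero (by norm_num) ha0), ha]
    push_cast
    field_simp
    linear_combination (16 * (ε : ℂ) ^ 2) * Complex.I_sq
  have h : ∀ ζ, Complex.exp (Complex.I * (⟪x, ζ⟫ : ℝ)) *
      Complex.exp (-((‖ζ - ξ‖ : ℂ) ^ 2 / 4)) *
      (Complex.exp (-(Complex.ofReal ε * Complex.I * Complex.ofReal (‖ζ‖ ^ 2))) *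
        Complex.exp (-((‖ζ - N‖ : ℂ) ^ 2 / 4))) =
      Complex.exp (-a * (‖ζ - (1 / 2 : ℝ) • (ξ + N)‖ : ℂ) ^ 2 +
        Complex.I * (⟪x - ε • (ξ + N), ζ⟫ : ℝ)) *
      Complex.exp (((-(1 / 8) * ‖ξ - N‖ ^ 2 : ℝ) : ℂ) +
        Complex.I * ((ε * ‖(1 / 2 : ℝ) • (ξ + N)‖ ^ 2 : ℝ) : ℂ)) := by
    intro ζ
    simp only [← Complex.exp_add]
    congr 1
    push_cast
    simp only [ofReal_norm_sq_eq_inner, inner_sub_left, inner_sub_right, inner_add_left,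
      inner_add_right, real_inner_smul_left, real_inner_smul_right]
    rw [real_inner_comm ξ ζ, real_inner_comm N ζ, real_inner_comm ξ N, ha]
    push_cast
    ring
  unfold freqSTFT
  simp_rw [h]
  rw [integral_mul_const, integral_gaussian_modulated hare, norm_mul, norm_mul, Complex.norm_exp,
    Complex.norm_exp, div_eq_mul_one_div _ (4 * a), hr, ← Complex.ofReal_pow]
  have h1 : (Complex.I * (⟪x - ε • (ξ + N), (1 / 2 : ℝ) • (ξ + N)⟫ : ℝ) -
      ((‖x - ε • (ξ + N)‖ ^ 2 : ℝ) : ℂ) * (((1 / (2 * (1 + 4 * ε ^ 2)) : ℝ) : ℂ) -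
      ((ε / (1 + 4 * ε ^ 2) : ℝ) : ℂ) * Complex.I)).re =
      -(1 / (2 * (1 + 4 * ε ^ 2))) * ‖x - ε • (ξ + N)‖ ^ 2 := by
    rw [Complex.sub_re, Complex.re_ofReal_mul, Complex.re_mul_ofReal, Complex.sub_re,
      Complex.re_ofReal_mul, Complex.ofReal_re, Complex.I_re]
    ring
  have h2 : (((-(1 / 8) * ‖ξ - N‖ ^ 2 : ℝ) : ℂ) +
      Complex.I * ((ε * ‖(1 / 2 : ℝ) • (ξ + N)‖ ^ 2 : ℝ) : ℂ)).re = -(1 / 8) * ‖ξ - N‖ ^ 2 := by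
    rw [Complex.add_re, Complex.re_mul_ofReal, Complex.ofReal_re, Complex.I_re]
    ring
  rw [h1, h2]
  ring

lemma exists_MNorm_schrod_gaussian_eq {p q : ℝ≥0∞} (hp : 1 ≤ p) (hq : 1 ≤ q) (ε : ℝ) :
    ∃ A : ℝ≥0∞, A ≠ 0 ∧ A ≠ ∞ ∧ ∀ (s : ℝ) (N : EuclideanSpace ℝ (Fin n))
      (f : SchwartzMap (EuclideanSpace ℝ (Fin n)) ℂ),
      (FT f = fun ζ => Complex.exp (-((‖ζ - N‖ : ℂ) ^ 2 / 4))) →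
      MNorm s p q (schrod ε f) = A * lpN q fun ξ => ENNReal.ofReal (jp s ξ) *
        ENNReal.ofReal (Real.exp (-(1 / 8) * ‖ξ - N‖ ^ 2)) := by
  have hpi : (π : ℂ) ≠ 0 := by exact_mod_cast Real.pi_ne_zero
  have hane : (1 / 2 + ε * Complex.I : ℂ) ≠ 0 := fun h => by
    simpa using congrArg Complex.re h
  have hpow : ∀ z : ℂ, z ≠ 0 → 0 < ‖z ^ (n / 2 : ℂ)‖ := fun z hz => by
    rw [norm_pos_iff, Ne, Complex.cpow_eq_zero_iff]
    exact fun h => hz h.1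
  set c : ℝ := ‖(π / (1 / 2 + ε * Complex.I) : ℂ) ^ (n / 2 : ℂ)‖ with hc
  have hc0 : 0 < c := hpow _ (div_ne_zero hpi hane)
  set r : ℝ := 1 / (2 * (1 + 4 * ε ^ 2)) with hr
  have hr0 : 0 < r := by positivity
  set P : ℝ≥0∞ := lpN p fun x : EuclideanSpace ℝ (Fin n) =>
    ENNReal.ofReal (Real.exp (-r * ‖x‖ ^ 2)) with hP
  have hP0 : P ≠ 0 := lpN_ne_zero (by fun_prop) fun x => by simp [Real.exp_pos]
  have hPtop : P ≠ ∞ := lpN_gaussian_ne_top hp hr0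
  set K : ℝ≥0∞ := ENNReal.ofReal (((2 * π) ^ n)⁻¹ * ‖(π : ℂ) ^ (n / 2 : ℂ)‖) with hK
  have hK0 : K ≠ 0 := by
    rw [hK, Ne, ENNReal.ofReal_eq_zero, not_le]
    exact mul_pos (by positivity) (hpow _ hpi)
  have hcP : ENNReal.ofReal c * P ≠ ∞ := ENNReal.mul_ne_top ENNReal.ofReal_ne_top hPtop
  refine ⟨K * (ENNReal.ofReal c * P), mul_ne_zero hK0 (mul_ne_zero (by simpa using hc0) hP0),
    ENNReal.mul_ne_top ENNReal.ofReal_ne_top hcP, fun s N f hf => ?_⟩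
  rw [MNorm_schrod_eq hp hq, mul_assoc, ← lpN_const_mul hq hcP, hf]
  congr 2
  funext ξ
  have h : ∀ x, ‖freqSTFT (fun ζ => Complex.exp (-(Complex.ofReal ε * Complex.I *
      Complex.ofReal (‖ζ‖ ^ 2))) * Complex.exp (-((‖ζ - N‖ : ℂ) ^ 2 / 4))) x ξ‖ₑ =
      ENNReal.ofReal (c * Real.exp (-(1 / 8) * ‖ξ - N‖ ^ 2)) *
        ENNReal.ofReal (Real.exp (-r * ‖x + -(ε • (ξ + N))‖ ^ 2)) := by
    intro x
    rw [← ofReal_norm, norm_freqSTFT_gaussian, ENNReal.ofReal_mul (by positivity),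
      ← sub_eq_add_neg]
  simp_rw [h]
  rw [lpN_const_mul hp ENNReal.ofReal_ne_top, lpN_comp_add_right p
    (fun x => ENNReal.ofReal (Real.exp (-r * ‖x‖ ^ 2))), ENNReal.ofReal_mul hc0.le]
  ring

lemma exists_jp_mul_gaussian_le {s : ℝ} (hs : s < 0) :
    ∃ B : ℝ, 0 ≤ B ∧ ∀ N ξ : EuclideanSpace ℝ (Fin n),
      jp s ξ * Real.exp (-(1 / 8) * ‖ξ - N‖ ^ 2) ≤
        jp s N * B * Real.exp (-(1 / 16) * ‖ξ - N‖ ^ 2) := by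
  obtain ⟨k, hk⟩ := exists_nat_ge (-(s / 2))
  refine ⟨k.factorial * (32 : ℝ) ^ k * Real.exp (1 / 16), by positivity, fun N ξ => ?_⟩
  set d : ℝ := ‖ξ - N‖ with hd
  have hpeetre : 1 + ‖N‖ ^ 2 ≤ (1 + ‖ξ‖ ^ 2) * (2 * (1 + d ^ 2)) := by
    have h1 : ‖N‖ ≤ ‖ξ‖ + d := by
      have := norm_sub_le ξ (ξ - N)
      rwa [sub_sub_cancel] at this
    have h2 : ‖N‖ ^ 2 ≤ (‖ξ‖ + d) ^ 2 := by gcongr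
    nlinarith [sq_nonneg (‖ξ‖ - d), mul_nonneg (sq_nonneg ‖ξ‖) (sq_nonneg d)]
  have hweight : jp s ξ * (2 * (1 + d ^ 2)) ^ (s / 2) ≤ jp s N := by
    unfold jp
    rw [← Real.mul_rpow (by positivity) (by positivity)]
    exact Real.rpow_le_rpow_of_nonpos (by positivity) hpeetre (by linarith)
  have hgrowth : (2 * (1 + d ^ 2)) ^ (-(s / 2)) ≤
      k.factorial * (32 : ℝ) ^ k * Real.exp (1 / 16) * Real.exp (1 / 16 * d ^ 2) := by
    have h1 : (2 * (1 + d ^ 2)) ^ (-(s / 2)) ≤ (2 * (1 + d ^ 2)) ^ k :=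
      (Real.rpow_le_rpow_of_exponent_le (by nlinarith [sq_nonneg d]) hk).trans_eq
        (Real.rpow_natCast _ _)
    have h2 := Real.pow_div_factorial_le_exp (2 * (1 + d ^ 2) / 32) (by positivity) k
    rw [div_pow, div_div, div_le_iff₀ (by positivity)] at h2
    rw [mul_assoc _ (Real.exp (1 / 16)), ← Real.exp_add]
    have h3 : 2 * (1 + d ^ 2) / 32 = 1 / 16 + 1 / 16 * d ^ 2 := by ring
    rw [h3] at h2
    linarith
  have hpos : 0 < (2 * (1 + d ^ 2)) ^ (s / 2) := Real.rpow_pos_of_pos (by positivity) _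
  rw [Real.rpow_neg (by positivity)] at hgrowth
  have hN : 0 ≤ jp s N := Real.rpow_nonneg (by positivity) _
  have hexp : Real.exp (-(1 / 8) * d ^ 2) =
      Real.exp (-(1 / 16) * d ^ 2) * Real.exp (-(1 / 16) * d ^ 2) := by
    rw [← Real.exp_add]
    ring_nf
  have hone : Real.exp (1 / 16 * d ^ 2) * Real.exp (-(1 / 16) * d ^ 2) = 1 := by
    rw [← Real.exp_add]
    ring_nf
    exact Real.exp_zero
  calc jp s ξ * Real.exp (-(1 / 8) * d ^ 2)
      ≤ jp s N * ((2 * (1 + d ^ 2)) ^ (s / 2))⁻¹ * Real.exp (-(1 / 8) * d ^ 2) := by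
        gcongr
        rwa [← div_eq_mul_inv, le_div_iff₀ hpos]
    _ ≤ jp s N * (k.factorial * (32 : ℝ) ^ k * Real.exp (1 / 16) * Real.exp (1 / 16 * d ^ 2)) *
          Real.exp (-(1 / 8) * d ^ 2) := by
        gcongr
    _ = jp s N * (k.factorial * (32 : ℝ) ^ k * Real.exp (1 / 16)) *
          Real.exp (-(1 / 16) * d ^ 2) *
          (Real.exp (1 / 16 * d ^ 2) * Real.exp (-(1 / 16) * d ^ 2)) := by
        rw [hexp]
        ring
    _ = _ := by rw [hone, mul_one]

lemma exists_lpN_jp_mul_gaussian_le {q : ℝ≥0∞} (hq : 1 ≤ q) {s : ℝ} (hs : s < 0) :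
    ∃ B : ℝ≥0∞, B ≠ ∞ ∧ ∀ N : EuclideanSpace ℝ (Fin n),
      (lpN q fun ξ => ENNReal.ofReal (jp s ξ) *
        ENNReal.ofReal (Real.exp (-(1 / 8) * ‖ξ - N‖ ^ 2))) ≤ ENNReal.ofReal (jp s N) * B := by
  obtain ⟨B, hB, h⟩ := exists_jp_mul_gaussian_le (n := n) hs
  refine ⟨ENNReal.ofReal B * lpN q fun ξ : EuclideanSpace ℝ (Fin n) =>
    ENNReal.ofReal (Real.exp (-(1 / 16) * ‖ξ‖ ^ 2)), ENNReal.mul_ne_top ENNReal.ofReal_ne_top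
    (lpN_gaussian_ne_top hq (by norm_num)), fun N => ?_⟩
  have hjp : ∀ ξ : EuclideanSpace ℝ (Fin n), 0 ≤ jp s ξ := fun ξ =>
    Real.rpow_nonneg (by positivity) _
  rw [← mul_assoc, ← ENNReal.ofReal_mul (hjp N), ← lpN_comp_add_right q
    (fun ξ => ENNReal.ofReal (Real.exp (-(1 / 16) * ‖ξ‖ ^ 2))) (-N),
    ← lpN_const_mul hq ENNReal.ofReal_ne_top]
  refine lpN_mono fun ξ => ?_
  rw [← ENNReal.ofReal_mul (hjp ξ), ← ENNReal.ofReal_mul (mul_nonneg (hjp N) hB),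
    ← sub_eq_add_neg]
  exact ENNReal.ofReal_le_ofReal (h N ξ)

lemma tendsto_jp_atTop (hn : 1 ≤ n) {s : ℝ} (hs : s < 0) :
    Filter.Tendsto (fun t : ℝ => ENNReal.ofReal
      (jp s (EuclideanSpace.single (⟨0, hn⟩ : Fin n) t))) Filter.atTop (nhds 0) := by
  have h1 : Filter.Tendsto (fun t : ℝ => (1 + t ^ 2) ^ (s / 2)) Filter.atTop (nhds 0) := by
    have h := (tendsto_rpow_neg_atTop (y := -(s / 2)) (by linarith)).comp
      (Filter.tendsto_atTop_add_const_left _ 1 (Filter.tendsto_pow_atTop (two_ne_zero)))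
    simpa [Function.comp_def] using h
  rw [← ENNReal.ofReal_zero]
  refine ENNReal.tendsto_ofReal (h1.congr fun t => ?_)
  simp [jp]

lemma nonneg_of_MNorm_schrod_le (hn : 1 ≤ n) {s : ℝ} {p q : ℝ≥0∞} (hp : 1 ≤ p) (hq : 1 ≤ q)
    {C : ℝ} (hC : ∀ f : SchwartzMap (EuclideanSpace ℝ (Fin n)) ℂ,
      MNorm 0 p q (schrod 1 ⇑f) ≤ ENNReal.ofReal C * MNorm s p q ⇑f) : 0 ≤ s := by
  by_contra! hs
  obtain ⟨A₁, hA₁, -, h₁⟩ := exists_MNorm_schrod_gaussian_eq (n := n) hp hq 1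
  obtain ⟨A₀, -, hA₀, h₀⟩ := exists_MNorm_schrod_gaussian_eq (n := n) hp hq 0
  obtain ⟨B, hB, hle⟩ := exists_lpN_jp_mul_gaussian_le (n := n) hq hs
  set Q : ℝ≥0∞ := lpN q fun ξ : EuclideanSpace ℝ (Fin n) =>
    ENNReal.ofReal (Real.exp (-(1 / 8) * ‖ξ‖ ^ 2)) with hQ
  have hQ0 : Q ≠ 0 := lpN_ne_zero (by fun_prop) fun x => by simp [Real.exp_pos]
  have hbound : ∀ N : EuclideanSpace ℝ (Fin n),
      A₁ * Q ≤ ENNReal.ofReal C * (A₀ * B) * ENNReal.ofReal (jp s N) := by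
    intro N
    obtain ⟨f, hf⟩ := exists_schwartz_FT_eq_gaussian N
    calc A₁ * Q = MNorm 0 p q (schrod 1 f) := by
          rw [h₁ 0 N f hf, hQ, ← lpN_comp_add_right q _ (-N)]
          simp [jp_zero, sub_eq_add_neg]
      _ ≤ ENNReal.ofReal C * MNorm s p q (schrod 0 f) := by
          rw [schrod_zero_schwartz]
          exact hC f
      _ ≤ ENNReal.ofReal C * (A₀ * (ENNReal.ofReal (jp s N) * B)) := by
          rw [h₀ s N f hf]
          gcongr
          exact hle N
      _ = _ := by ring
  have hlim := ENNReal.Tendsto.const_mul (a := ENNReal.ofReal C * (A₀ * B))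
    (tendsto_jp_atTop hn hs)
    (Or.inr (ENNReal.mul_ne_top ENNReal.ofReal_ne_top (ENNReal.mul_ne_top hA₀ hB)))
  rw [mul_zero] at hlim
  have h := ge_of_tendsto' hlim fun t => hbound (EuclideanSpace.single ⟨0, hn⟩ t)
  exact mul_ne_zero hA₁ hQ0 (le_antisymm h zero_le)

end Sharpness

/-- For `n ≥ 1`, `s ∈ ℝ`, `1 ≤ p, q ≤ ∞`, the Schrödinger operator `e^{iΔ}` is bounded from
`M^s_{p,q}` to `M_{p,q}` (on Schwartz functions) if and only if `s ≥ 0`. -/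
theorem schrodinger_modulation_bounded_iff (n : ℕ) (hn : 1 ≤ n) (s : ℝ) (p q : ℝ≥0∞)
    (hp : 1 ≤ p) (hq : 1 ≤ q) :
    (∃ C : ℝ, 0 < C ∧ ∀ f : SchwartzMap (EuclideanSpace ℝ (Fin n)) ℂ,
      MNorm 0 p q (schrod 1 ⇑f) ≤ ENNReal.ofReal C * MNorm s p q ⇑f) ↔ 0 ≤ s := by
  constructor
  · rintro ⟨C, -, hC⟩
    exact nonneg_of_MNorm_schrod_le hn hp hq hC
  · exact fun hs => exists_MNorm_schrod_le hs hp hq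

end
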